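/- arXiv:1902.06690 — 2 statements merged into one kernel-verified Lean document; each statement's English description precedes it below -/
import Mathlib

section
/- For every x ∈ ℂ, erf(x) + erf(xα) + erf(xα²) + erf(xα³) + erf(xα⁴) = (10/√π) ∑_{m=0}^∞ (−1)^m x^{10m+5} / ( (5m+2)! (10m+5) ) (the right-hand side being the hypergeometric series (x⁵/√π) · ₁F₅[1/2; 3/2, 3/5, 4/5, 6/5, 7/5; −(x²/5)⁵] written termwise). -/
open Complex

/-- The error function, given by its everywhere-convergent Maclaurin series. -/
noncomputable def erf (z : ℂ) : ℂ :=
  2 / (Real.sqrt Real.pi : ℂ) *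
    ∑' n : ℕ, (-1) ^ n * z ^ (2 * n + 1) / ((n.factorial : ℂ) * (2 * n + 1))

theorem summable_erf_series (z : ℂ) :
    Summable fun n : ℕ ↦ (-1) ^ n * z ^ (2 * n + 1) / ((n.factorial : ℂ) * (2 * n + 1)) := by
  refine .of_norm_bounded ((Real.summable_pow_div_factorial (‖z‖ ^ 2)).mul_left ‖z‖) fun n ↦ ?_
  have h : ‖(2 * n + 1 : ℂ)‖ = 2 * n + 1 := by
    exact_mod_cast Complex.norm_natCast (2 * n + 1)
  rw [norm_div, norm_mul, norm_mul, norm_pow, norm_pow, norm_neg, norm_one, one_pow, one_mul,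
    Complex.norm_natCast, h, ← pow_mul, ← mul_div_assoc, ← pow_succ']
  gcongr
  exact le_mul_of_one_le_right (by positivity) (by linarith [n.cast_nonneg (α := ℝ)])

theorem IsPrimitiveRoot.sum_pow_mul_eq_ite {R : Type*} [CommRing R] [IsDomain R] {ζ : R} {k : ℕ}
    (hζ : IsPrimitiveRoot ζ k) (n : ℕ) :
    ∑ j ∈ Finset.range k, (ζ ^ j) ^ n = if k ∣ n then (k : R) else 0 := by
  simp_rw [← pow_mul, mul_comm _ n, pow_mul]
  split_ifs with h
  · simp [(hζ.pow_eq_one_iff_dvd n).2 h]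
  · have hne : ζ ^ n - 1 ≠ 0 := sub_ne_zero.2 fun h1 ↦ h ((hζ.pow_eq_one_iff_dvd n).1 h1)
    refine (mul_eq_zero.1 ?_).resolve_right hne
    rw [geom_sum_mul, ← pow_mul, mul_comm, pow_mul, hζ.pow_eq_one, one_pow, sub_self]

theorem sum_erf_mul_pow {ζ : ℂ} {k : ℕ} (hζ : IsPrimitiveRoot ζ k) (x : ℂ) :
    ∑ j ∈ Finset.range k, erf (x * ζ ^ j) = 2 / (Real.sqrt Real.pi : ℂ) *
      ∑' n : ℕ, (-1) ^ n * x ^ (2 * n + 1) / ((n.factorial : ℂ) * (2 * n + 1)) *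
        if k ∣ 2 * n + 1 then (k : ℂ) else 0 := by
  simp_rw [erf]
  rw [← Finset.mul_sum, ← Summable.tsum_finsetSum fun j _ ↦ summable_erf_series _]
  congr 2 with n
  rw [← hζ.sum_pow_mul_eq_ite, Finset.mul_sum]
  refine Finset.sum_congr rfl fun j _ ↦ ?_
  rw [mul_pow]
  ring

theorem erf_sum_fifth_roots (x : ℂ) :
    let α : ℂ := Complex.exp (2 * Real.pi * Complex.I / 5)
    erf x + erf (x * α) + erf (x * α ^ 2) + erf (x * α ^ 3) + erf (x * α ^ 4) =
      10 / (Real.sqrt Real.pi : ℂ) *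
        ∑' m : ℕ, (-1) ^ m * x ^ (10 * m + 5) /
          (((5 * m + 2).factorial : ℂ) * (10 * m + 5)) := by
  intro α
  have hα : IsPrimitiveRoot α 5 := by
    simpa [α] using Complex.isPrimitiveRoot_exp 5 (by norm_num)
  have hsum := sum_erf_mul_pow hα x
  simp only [Finset.sum_range_succ, Finset.sum_range_zero, zero_add, pow_zero, pow_one,
    mul_one] at hsum
  have hinj : Function.Injective fun m : ℕ ↦ 5 * m + 2 := fun a b h ↦ by
    simpa using h
  rw [hsum, ← hinj.tsum_eq]
  · rw [show (10 : ℂ) / (Real.sqrt Real.pi : ℂ) = 2 / (Real.sqrt Real.pi : ℂ) * 5 by ring,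
      mul_assoc, ← tsum_mul_left (a := (5 : ℂ))]
    refine congrArg _ (tsum_congr fun m ↦ ?_)
    have hdvd : 5 ∣ 2 * (5 * m + 2) + 1 := by lia
    have hsign : (-1 : ℂ) ^ (5 * m + 2) = (-1) ^ m := by
      rw [pow_add, pow_mul]
      norm_num
    rw [if_pos hdvd, hsign, show 2 * (5 * m + 2) + 1 = 10 * m + 5 by ring]
    push_cast
    rw [show (2 * (5 * m + 2) + 1 : ℂ) = 10 * m + 5 by ring]
    ring
  · intro n hn
    have hdvd : 5 ∣ 2 * n + 1 := by
      by_contra h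
      simp [h] at hn
    exact ⟨n / 5, by dsimp only; lia⟩
end

section
/- Let a ∈ ℂ be such that a is not zero or a negative integer, and let x be a positive real number. For k = 0, 1, 2, 3, 4 set γ_k = x^{2a} e^{4πika/5} ∑_{n=0}^∞ (−1)^n (x² e^{4πik/5})^n / (n! (a+n)), the value of the lower incomplete gamma function γ(a, (xα^k)²) given by its series, where x^{2a} = exp(2a·log x) with the real logarithm and e^{4πika/5} = exp(4πika/5). Then e^{16πia/5} γ_0 + e^{12πia/5} γ_1 + e^{8πia/5} γ_2 + e^{4πia/5} γ_3 + γ_4 = 5 x^{2a} e^{16πia/5} ∑_{m=0}^∞ (−1)^m x^{10m} / ( (5m)! (a + 5m) ) (the right-hand side being the hypergeometric series (5 x^{2a} α^{8a} / a) · ₁F₅[a/5; (a+5)/5, 1/5, 2/5, 3/5, 4/5; −(x²/5)⁵] written termwise, with α^{2ka} interpreted as exp(4πika/5)). -/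
open Complex

lemma IsPrimitiveRoot.sum_range_pow_pow {R : Type*} [CommRing R] [IsDomain R] {ω : R} {N : ℕ}
    (hω : IsPrimitiveRoot ω N) (n : ℕ) :
    ∑ k ∈ Finset.range N, (ω ^ k) ^ n = if N ∣ n then (N : R) else 0 := by
  simp_rw [← pow_mul, mul_comm _ n, pow_mul]
  split_ifs with h
  · simp [(hω.pow_eq_one_iff_dvd n).2 h]
  · have hne : ω ^ n - 1 ≠ 0 := sub_ne_zero.2 (mt (hω.pow_eq_one_iff_dvd n).1 h)
    refine (mul_eq_zero.1 ?_).resolve_left hne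
    rw [mul_geom_sum, ← pow_mul, mul_comm, pow_mul, hω.pow_eq_one, one_pow, sub_self]

/-- The roots of unity filter: averaging a power series over the rotations of its argument by the
`N`-th roots of unity keeps the terms whose index is divisible by `N`. -/
lemma IsPrimitiveRoot.sum_tsum_mul_pow {ω : ℂ} {N : ℕ} (hN : N ≠ 0) (hω : IsPrimitiveRoot ω N)
    (c : ℕ → ℂ) (hc : ∀ k, Summable fun n => c n * (ω ^ k) ^ n) :
    ∑ k ∈ Finset.range N, ∑' n, c n * (ω ^ k) ^ n = N * ∑' m, c (N * m) := by
  rw [← Summable.tsum_finsetSum fun k _ => hc k, ← tsum_mul_left]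
  simp_rw [← Finset.mul_sum, hω.sum_range_pow_pow]
  have hinj : Function.Injective fun m : ℕ => N * m := mul_right_injective₀ hN
  rw [← hinj.tsum_eq]
  · simp [mul_comm]
  · intro n hn
    by_contra h
    have hdvd : ¬ N ∣ n := fun ⟨m, hm⟩ => h ⟨m, hm.symm⟩
    exact hn (by simp [hdvd])

lemma summable_pow_div_factorial_mul_add (a z : ℂ) :
    Summable fun n : ℕ => z ^ n / ((n.factorial : ℂ) * (a + n)) := by
  have hinv : Filter.Tendsto (fun n : ℕ => (a + n)⁻¹) Filter.atTop (nhds 0) :=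
    Filter.tendsto_inv₀_cobounded.comp
      ((tendsto_const_add_cobounded a).comp tendsto_natCast_atTop_cobounded)
  refine summable_of_isBigO_nat (g := fun n => ‖z‖ ^ n / n.factorial)
    (Real.summable_pow_div_factorial ‖z‖) ?_
  have h := (Asymptotics.isBigO_refl (fun n : ℕ => z ^ n / (n.factorial : ℂ)) Filter.atTop).mul
    (hinv.isBigO_one ℂ)
  refine Asymptotics.IsBigO.trans (h.congr_left fun n => ?_) (.of_norm_le fun n => ?_)
  · rw [← div_eq_mul_inv, div_div]
  · simp

theorem incompleteGamma_sum_fifth_roots (a : ℂ) (ha : ∀ m : ℕ, a ≠ -m)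
    (x : ℝ) (hx : 0 < x) :
    let γ : ℕ → ℂ := fun k =>
      Complex.exp (2 * a * Real.log x) * Complex.exp (4 * Real.pi * Complex.I * k * a / 5) *
        ∑' n : ℕ, (-1) ^ n * ((x : ℂ) ^ 2 * Complex.exp (4 * Real.pi * Complex.I * k / 5)) ^ n /
          ((n.factorial : ℂ) * (a + n))
    Complex.exp (16 * Real.pi * Complex.I * a / 5) * γ 0 +
        Complex.exp (12 * Real.pi * Complex.I * a / 5) * γ 1 +
        Complex.exp (8 * Real.pi * Complex.I * a / 5) * γ 2 +
        Complex.exp (4 * Real.pi * Complex.I * a / 5) * γ 3 + γ 4 =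
      5 * Complex.exp (2 * a * Real.log x) * Complex.exp (16 * Real.pi * Complex.I * a / 5) *
        ∑' m : ℕ, (-1) ^ m * (x : ℂ) ^ (10 * m) / (((5 * m).factorial : ℂ) * (a + 5 * m)) := by
  intro γ
  set ω : ℂ := exp (4 * Real.pi * I / 5) with hω_def
  have hω : IsPrimitiveRoot ω 5 := by
    convert Complex.isPrimitiveRoot_exp_of_coprime 2 5 (by norm_num) (by norm_num) using 2
    push_cast
    ring
  set c : ℕ → ℂ := fun n => (-(x : ℂ) ^ 2) ^ n / ((n.factorial : ℂ) * (a + n)) with hc_def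
  have hc (k : ℕ) : Summable fun n => c n * (ω ^ k) ^ n := by
    refine (summable_pow_div_factorial_mul_add a (-(x : ℂ) ^ 2 * ω ^ k)).congr fun n => ?_
    rw [mul_pow, mul_div_right_comm]
  have hγ (k : ℕ) : γ k = exp (2 * a * Real.log x) * exp (4 * Real.pi * I * k * a / 5) *
      ∑' n, c n * (ω ^ k) ^ n := by
    have hk : exp (4 * Real.pi * I * k / 5) = ω ^ k := by
      rw [hω_def, ← exp_nat_mul]
      ring_nf
    simp only [γ, hk, hc_def]
    congr 2 with n
    rw [← mul_pow, div_mul_eq_mul_div, ← mul_pow]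
    ring_nf
  have hfilter := hω.sum_tsum_mul_pow (by norm_num) c hc
  have hterm (m : ℕ) : c (5 * m) =
      (-1) ^ m * (x : ℂ) ^ (10 * m) / (((5 * m).factorial : ℂ) * (a + 5 * m)) := by
    have hpow : (-(x : ℂ) ^ 2) ^ (5 * m) = (-1) ^ m * (x : ℂ) ^ (10 * m) := by
      rw [pow_mul, pow_mul, ← mul_pow]
      ring_nf
    simp only [hc_def, hpow]
    push_cast
    rfl
  have hphase (p q : ℂ) (h : p + q = 16) : exp (p * Real.pi * I * a / 5) *
      exp (q * Real.pi * I * a / 5) = exp (16 * Real.pi * I * a / 5) := by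
    rw [← exp_add, ← h]
    ring_nf
  have h0 : exp (4 * Real.pi * I * (0 : ℕ) * a / 5) = 1 := by simp
  have h1 : exp (4 * Real.pi * I * (1 : ℕ) * a / 5) = exp (4 * Real.pi * I * a / 5) := by simp
  have h2 : exp (4 * Real.pi * I * (2 : ℕ) * a / 5) = exp (8 * Real.pi * I * a / 5) := by
    push_cast; ring_nf
  have h3 : exp (4 * Real.pi * I * (3 : ℕ) * a / 5) = exp (12 * Real.pi * I * a / 5) := by
    push_cast; ring_nf
  have h4 : exp (4 * Real.pi * I * (4 : ℕ) * a / 5) = exp (16 * Real.pi * I * a / 5) := by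
    push_cast; ring_nf
  simp only [Finset.sum_range_succ, Finset.sum_range_zero, zero_add, hterm, Nat.cast_ofNat]
    at hfilter
  rw [hγ, hγ, hγ, hγ, hγ, h0, h1, h2, h3, h4]
  set E := exp (2 * a * Real.log x)
  linear_combination E * exp (16 * Real.pi * I * a / 5) * hfilter +
    E * (∑' n, c n * (ω ^ 1) ^ n) * hphase 12 4 (by norm_num) +
    E * (∑' n, c n * (ω ^ 2) ^ n) * hphase 8 8 (by norm_num) +
    E * (∑' n, c n * (ω ^ 3) ^ n) * hphase 4 12 (by norm_num)
end
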